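/- arXiv:0811.2389 — 3 statements merged into one kernel-verified Lean document; each statement's English description precedes it below -/
import Mathlib

section
/- Let G be a finitely generated group, E an admissible family of subgroups of G, and let T and T' be minimal E-trees. Then T dominates T' if and only if B(T') ⊆ B(T). Consequently, B(T) = B(T') if and only if T and T' belong to the same deformation space. -/
open scoped Pointwise symmDiff

namespace SSRN

section Group
variable {G : Type*} [Group G]

/-- A subset of `G` is `H`-finite if it is contained in finitely many orbits of the
action of `H` on `G` by left multiplication. -/
def HFin (H : Subgroup G) (X : Set G) : Prop :=
  ∃ F : Finset G, X ⊆ ⋃ f ∈ F, (· * f) '' (H : Set G)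

/-- Two subsets of `G` are `H`-equivalent if their symmetric difference is `H`-finite. -/
def AIEquiv (H : Subgroup G) (X Y : Set G) : Prop := HFin H (X ∆ Y)

/-- `X` is an `H`-almost invariant subset of `G`. -/
def IsAI (H : Subgroup G) (X : Set G) : Prop :=
  (∀ h ∈ H, (h * ·) '' X = X) ∧ ∀ s : G, HFin H (((· * s) '' X) ∆ X)

/-- `X` is a non-trivial `H`-almost invariant subset of `G`. -/
def NontrivAI (H : Subgroup G) (X : Set G) : Prop :=
  IsAI H X ∧ ¬ HFin H X ∧ ¬ HFin H Xᶜ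

/-- The `H`-almost invariant set `X` crosses `Y`: none of the four corners is `H`-finite. -/
def Crosses (H : Subgroup G) (X Y : Set G) : Prop :=
  ¬ HFin H (X ∩ Y) ∧ ¬ HFin H (X ∩ Yᶜ) ∧ ¬ HFin H (Xᶜ ∩ Y) ∧ ¬ HFin H (Xᶜ ∩ Yᶜ)

/-- Crossing of (non-trivial) almost invariant sets, quantifying over the groups over
which they are almost invariant. -/
def CrossesAny (X X' : Set G) : Prop :=
  ∃ H K : Subgroup G, NontrivAI H X ∧ NontrivAI K X' ∧ Crosses H X X'

/-- `X` and `X'` determine the same unordered pair `{[X], [X*]}` of equivalence classes. -/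
def SamePair (X X' : Set G) : Prop :=
  ∃ H : Subgroup G, NontrivAI H X ∧ (HFin H (X ∆ X') ∨ HFin H (X ∆ X'ᶜ))

/-- An admissible family of subgroups: conjugacy invariant, closed under commensurability,
and no member contains another with infinite index. -/
def Admissible (E : Set (Subgroup G)) : Prop :=
  (∀ H ∈ E, ∀ g : G, (MulAut.conj g • H) ∈ E) ∧
  (∀ H ∈ E, ∀ K : Subgroup G, Subgroup.Commensurable K H → K ∈ E) ∧
  (∀ A ∈ E, ∀ B ∈ E, A ≤ B → A.relIndex B ≠ 0)

end Group

section Tree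

variable {V : Type*}

/-- The stabilizer of an edge `e : Sym2 V` under the action of `G`. -/
def edgeStab (G : Type*) [Group G] [MulAction G V] (e : Sym2 V) : Subgroup G where
  carrier := {g | Sym2.map (g • ·) e = e}
  one_mem' := by
    show Sym2.map ((1 : G) • ·) e = e
    have : ((1 : G) • · : V → V) = id := by funext v; simp
    rw [this, Sym2.map_id]; rfl
  mul_mem' := by
    intro a b ha hb
    show Sym2.map ((a * b) • ·) e = e
    have : ((a * b) • · : V → V) = (a • ·) ∘ (b • ·) := by funext v; simp [mul_smul]
    rw [this, ← Sym2.map_map, hb, ha]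
  inv_mem' := by
    intro a ha
    show Sym2.map (a⁻¹ • ·) e = e
    conv_lhs => rw [← ha]
    rw [Sym2.map_map]
    have : ((a⁻¹ • ·) ∘ (a • ·) : V → V) = id := by funext v; simp
    rw [this, Sym2.map_id]; rfl

variable (T : SimpleGraph V)

/-- `G` acts on the graph `T` by graph automorphisms. -/
def ActsOn (G : Type*) [Group G] [MulAction G V] : Prop :=
  ∀ (g : G) (u v : V), T.Adj u v → T.Adj (g • u) (g • v)

/-- The action of `G` on `T` is without inversions. -/
def NoInversions (G : Type*) [Group G] [MulAction G V] : Prop :=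
  ∀ (g : G) (u v : V), T.Adj u v → ¬ (g • u = v ∧ g • v = u)

/-- `w` lies between `u` and `v`: it is on every path from `u` to `v`. -/
def Btw (u w v : V) : Prop := ∀ p : T.Walk u v, p.IsPath → w ∈ p.support

/-- The action of `G` on the tree `T` is minimal: every nonempty invariant subtree
(convex invariant set of vertices) is the whole vertex set. -/
def MinimalAction (G : Type*) [Group G] [MulAction G V] : Prop :=
  ∀ A : Set V, A.Nonempty → (∀ (g : G), ∀ a ∈ A, g • a ∈ A) →
    (∀ u ∈ A, ∀ v ∈ A, ∀ w : V, Btw T u w v → w ∈ A) → A = Set.univ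

/-- The action of `G` is non-trivial: there is no global fixed vertex. -/
def NontrivialAction (G : Type*) [Group G] [MulAction G V] : Prop :=
  ¬ ∃ v : V, ∀ g : G, g • v = v

/-- `T` is an `E`-tree: all edge stabilizers belong to `E`. -/
def IsETree (G : Type*) [Group G] [MulAction G V] (E : Set (Subgroup G)) : Prop :=
  ∀ e ∈ T.edgeSet, edgeStab G e ∈ E

/-- There are finitely many `G`-orbits of edges. -/
def FinEdgeOrbits (G : Type*) [Group G] [MulAction G V] : Prop :=
  ∃ F : Finset (Sym2 V), ∀ e ∈ T.edgeSet, ∃ e₀ ∈ F, ∃ g : G, Sym2.map (g • ·) e₀ = e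

/-- A cylinder of `T`: an equivalence class of edges for commensurability of stabilizers. -/
def IsCylinder (G : Type*) [Group G] [MulAction G V] (Y : Set (Sym2 V)) : Prop :=
  Y.Nonempty ∧ Y ⊆ T.edgeSet ∧
    ∀ e ∈ Y, ∀ e' ∈ T.edgeSet,
      (e' ∈ Y ↔ Subgroup.Commensurable (edgeStab G e) (edgeStab G (V := V) e'))

/-- The set of vertices of a set of edges (e.g. of a cylinder). -/
def cylVerts (Y : Set (Sym2 V)) : Set V := {v | ∃ e ∈ Y, v ∈ e}

/-- The boundary of a cylinder: its vertices lying in another cylinder,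
i.e. incident to an edge outside the cylinder. -/
def cylBoundary (Y : Set (Sym2 V)) : Set V :=
  {v | v ∈ cylVerts Y ∧ ∃ e ∈ T.edgeSet, v ∈ e ∧ e ∉ Y}

/-- `H` belongs to the commensurability class associated to the cylinder `Y`. -/
def InClassOf (G : Type*) [Group G] [MulAction G V] (Y : Set (Sym2 V)) (H : Subgroup G) : Prop :=
  ∃ e ∈ Y, Subgroup.Commensurable H (edgeStab G e)

/-- The coboundary of a set of vertices: edges with exactly one endpoint in it. -/
def cobdry (S : Set V) : Set (Sym2 V) :=
  {e | e ∈ T.edgeSet ∧ ∃ u v : V, e = s(u, v) ∧ u ∈ S ∧ v ∉ S}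

/-- `S` is a special forest based on the cylinder `Y`. -/
def IsSpecialForest (S : Set V) (Y : Set (Sym2 V)) : Prop :=
  (cobdry T S).Finite ∧ cobdry T S ⊆ Y

/-- A set of vertices is non-trivial if it is neither finite nor cofinite. -/
def NontrivForest (S : Set V) : Prop := ¬ S.Finite ∧ ¬ (Sᶜ : Set V).Finite

/-- The almost invariant set associated to a set of vertices. -/
def XS (G : Type*) [Group G] [MulAction G V] (v₀ : V) (S : Set V) : Set G :=
  {g : G | g • v₀ ∈ S}

/-- The component `T_e` of `T` minus the open edge `e = s(u,v)` containing the terminal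
vertex `v`. -/
def halfTree (u v : V) : Set V :=
  {w | ∃ p : T.Walk v w, p.IsPath ∧ s(u, v) ∉ p.edges}

/-- The almost invariant set `Z_e` dual to the oriented edge `(u, v)`. -/
def Ze (G : Type*) [Group G] [MulAction G V] (v₀ u v : V) : Set G :=
  XS G v₀ (halfTree T u v)

/-- `v` has finitely many incident edges in `Y`. -/
def FiniteValenceIn (Y : Set (Sym2 V)) (v : V) : Prop := {e | e ∈ Y ∧ v ∈ e}.Finite

/-- The peripheral special forest `S_{v,Y}`: the component of `v` in `T` minus the open
edges of `Y` incident to `v`. -/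
def periForest (Y : Set (Sym2 V)) (v : V) : Set V :=
  {w | ∃ p : T.Walk v w, p.IsPath ∧ ∀ e ∈ Y, v ∈ e → e ∉ p.edges}

/-- The peripheral almost invariant set `X_{v,Y}`. -/
def XvY (G : Type*) [Group G] [MulAction G V] (v₀ : V) (Y : Set (Sym2 V)) (v : V) : Set G :=
  XS G v₀ (periForest T Y v)

/-- A peripheral special forest: one equivalent to some `S_{v,Y}`. -/
def PeripheralForest (G : Type*) [Group G] [MulAction G V] (S : Set V) : Prop :=
  ∃ (Y : Set (Sym2 V)) (v : V), IsCylinder T G Y ∧ v ∈ cylBoundary T Y ∧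
    FiniteValenceIn Y v ∧ (S ∆ periForest T Y v).Finite

/-- The Boolean algebra `B_C(T)` of (representatives of) almost invariant sets based on the
cylinder `Y`: the smallest family containing the sets `Z_e`, `e ∈ Y`, closed under
complement, intersection and `H`-equivalence. -/
def BCT {G : Type*} [Group G] [MulAction G V] (v₀ : V) (Y : Set (Sym2 V)) (H : Subgroup G) :
    Set (Set G) :=
  ⋂₀ {F : Set (Set G) |
    (∀ u v : V, T.Adj u v → s(u, v) ∈ Y → Ze T G v₀ u v ∈ F) ∧
    (∀ X ∈ F, Xᶜ ∈ F) ∧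
    (∀ X ∈ F, ∀ X' ∈ F, X ∩ X' ∈ F) ∧
    (∀ X ∈ F, ∀ X' : Set G, HFin H (X ∆ X') → X' ∈ F)}

/-- The set `B(T)` of (representatives of) almost invariant sets based on `T`. -/
def BT (G : Type*) [Group G] [MulAction G V] (v₀ : V) : Set (Set G) :=
  {X | ∃ Y : Set (Sym2 V), IsCylinder T G Y ∧ ∃ e ∈ Y, X ∈ BCT T v₀ Y (edgeStab G e)}

/-- Elements of `B(T)` that are non-trivial almost invariant sets. -/
def NontrivB (G : Type*) [Group G] [MulAction G V] (v₀ : V) : Set (Set G) :=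
  {X | X ∈ BT T G v₀ ∧ ∃ H : Subgroup G, NontrivAI H X}

/-- One step of the relation generating cross-connected components. -/
def ccStep (G : Type*) [Group G] [MulAction G V] (v₀ : V) (X X' : Set G) : Prop :=
  X ∈ NontrivB T G v₀ ∧ X' ∈ NontrivB T G v₀ ∧ (CrossesAny X X' ∨ SamePair X X')

/-- The equivalence relation generated by crossing (and identification of equivalent sets
and complements) on `B(T)`. -/
def ccRel (G : Type*) [Group G] [MulAction G V] (v₀ : V) : Set G → Set G → Prop :=
  Relation.EqvGen (ccStep T G v₀)

/-- The cross-connected component of (the pair determined by) `X`. -/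
def ccOf (G : Type*) [Group G] [MulAction G V] (v₀ : V) (X : Set G) : Set (Set G) :=
  {X' | ccRel T G v₀ X X'}

/-- `C` is a cross-connected component of `B(T)`. -/
def IsCCC (G : Type*) [Group G] [MulAction G V] (v₀ : V) (C : Set (Set G)) : Prop :=
  ∃ X ∈ NontrivB T G v₀, C = ccOf T G v₀ X

/-- A cross-connected component is based on the cylinder `Y` if its members are almost
invariant over subgroups in the commensurability class of `Y`. -/
def CCCBasedOn (G : Type*) [Group G] [MulAction G V] (Y : Set (Sym2 V)) (C : Set (Set G)) :
    Prop :=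
  ∃ X ∈ C, ∃ H : Subgroup G, InClassOf G Y H ∧ NontrivAI H X

/-- A peripheral cross-connected component. -/
def PeripheralCCC (G : Type*) [Group G] [MulAction G V] (v₀ : V) (C : Set (Set G)) : Prop :=
  ∃ (Y : Set (Sym2 V)) (v : V), IsCylinder T G Y ∧ v ∈ cylBoundary T Y ∧
    FiniteValenceIn Y v ∧ XvY T G v₀ Y v ∈ C

/-- Betweenness of (distinct) cross-connected components. -/
def CCCBetween {G : Type*} [Group G] (C₁ C₂ C₃ : Set (Set G)) : Prop :=
  C₁ ≠ C₂ ∧ C₂ ≠ C₃ ∧ C₁ ≠ C₃ ∧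
    ∃ X₁ ∈ C₁, ∃ X₂ ∈ C₂, ∃ X₃ ∈ C₃, X₁ ⊆ X₂ ∧ X₂ ⊆ X₃

/-- A star of cross-connected components. -/
def IsStar (G : Type*) [Group G] [MulAction G V] (v₀ : V) (St : Set (Set (Set G))) : Prop :=
  (∀ C ∈ St, IsCCC T G v₀ C) ∧ St.Nontrivial ∧
  (∀ C ∈ St, ∀ C' ∈ St, ∀ C'' : Set (Set G), IsCCC T G v₀ C'' → ¬ CCCBetween C C'' C') ∧
  (∀ St' : Set (Set (Set G)), St ⊆ St' → (∀ C ∈ St', IsCCC T G v₀ C) →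
    (∀ C ∈ St', ∀ C' ∈ St', ∀ C'' : Set (Set G), IsCCC T G v₀ C'' → ¬ CCCBetween C C'' C') →
    St' = St)

/-- The regular neighbourhood `RN(B(T))`: the bipartite graph on cross-connected
components and stars. -/
def RNGraph (G : Type*) [Group G] [MulAction G V] (v₀ : V) :
    SimpleGraph ({C : Set (Set G) // IsCCC T G v₀ C} ⊕
      {St : Set (Set (Set G)) // IsStar T G v₀ St}) where
  Adj x y :=
    match x, y with
    | Sum.inl C, Sum.inr St => C.1 ∈ St.1
    | Sum.inr St, Sum.inl C => C.1 ∈ St.1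
    | _, _ => False
  symm := ⟨by rintro (C | St) (C' | St') h <;> exact h⟩
  loopless := ⟨by rintro (C | St) h <;> exact h⟩

/-- Vertices of `T` lying in at least two cylinders. -/
def TcV0 (G : Type*) [Group G] [MulAction G V] : Set V :=
  {v | ∃ Y Y' : Set (Sym2 V), IsCylinder T G Y ∧ IsCylinder T G Y' ∧ Y ≠ Y' ∧
    v ∈ cylVerts Y ∧ v ∈ cylVerts Y'}

/-- The tree of cylinders `T_c` of `T`, as a bipartite graph. -/
def TcGraph (G : Type*) [Group G] [MulAction G V] :
    SimpleGraph ({v : V // v ∈ TcV0 T G} ⊕ {Y : Set (Sym2 V) // IsCylinder T G Y}) where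
  Adj x y :=
    match x, y with
    | Sum.inl v, Sum.inr Y => v.1 ∈ cylVerts Y.1
    | Sum.inr Y, Sum.inl v => v.1 ∈ cylVerts Y.1
    | _, _ => False
  symm := ⟨by rintro (v | Y) (v' | Y') h <;> exact h⟩
  loopless := ⟨by rintro (v | Y) h <;> exact h⟩


/-- `T` dominates `T'`: there is a `G`-equivariant map. -/
def Dominates (G : Type*) [Group G] {V V' : Type*} [MulAction G V] [MulAction G V']
    (T : SimpleGraph V) (T' : SimpleGraph V') : Prop :=
  ∃ f : V → V', ∀ (g : G) (x : V), f (g • x) = g • f x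

end Tree

section Subdiv

variable {α β : Type*}

/-- `S` is a subdivision of `Γ` via the vertex embedding `f`. -/
def SubdivVia (f : α → β) (S : SimpleGraph β) (Γ : SimpleGraph α) : Prop :=
  Function.Injective f ∧
  (∀ b : β, b ∉ Set.range f → ∃ x y : β, x ≠ y ∧ S.neighborSet b = {x, y}) ∧
  (∀ u : α, Nonempty (Γ.neighborSet u ≃ S.neighborSet (f u))) ∧
  (∀ u v : α, Γ.Adj u v ↔ ∃ p : S.Walk (f u) (f v), p.IsPath ∧ 1 ≤ p.length ∧
      ∀ w ∈ p.support, w ∈ Set.range f → w = f u ∨ w = f v) ∧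
  (∀ e ∈ S.edgeSet, ∃ (u v : α) (p : S.Walk (f u) (f v)), Γ.Adj u v ∧ p.IsPath ∧
      (∀ w ∈ p.support, w ∈ Set.range f → w = f u ∨ w = f v) ∧ e ∈ p.edges)

/-- `S` is (isomorphic to) a subdivision of `Γ`. -/
def IsSubdivision (S : SimpleGraph β) (Γ : SimpleGraph α) : Prop :=
  ∃ f : α → β, SubdivVia f S Γ

end Subdiv

end SSRN

namespace SSRN

section Helpers

/-- An edge `e` separates `x` from `y`. -/
def Sep {V : Type*} (T : SimpleGraph V) (e : Sym2 V) (x y : V) : Prop :=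
  ∀ p : T.Walk x y, e ∈ p.edges

/-- Action on edges. -/
def eact {G V : Type*} [Group G] [MulAction G V] (g : G) (e : Sym2 V) : Sym2 V :=
  Sym2.map (g • ·) e

section
variable {G V : Type*} [Group G] [MulAction G V]

lemma eact_mk (g : G) (x y : V) : eact g s(x, y) = s(g • x, g • y) := rfl

lemma eact_one (e : Sym2 V) : eact (1 : G) e = e := by
  induction e with | _ x y => simp [eact_mk]

lemma eact_mul (g h : G) (e : Sym2 V) : eact (g * h) e = eact g (eact h e) := by
  induction e with | _ x y => simp [eact_mk, mul_smul]

lemma eact_inv (g : G) (e : Sym2 V) : eact g⁻¹ (eact g e) = e := by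
  rw [← eact_mul]; simp [eact_one]

lemma eact_inv' (g : G) (e : Sym2 V) : eact g (eact g⁻¹ e) = e := by
  rw [← eact_mul]; simp [eact_one]

lemma mem_edgeStab (g : G) (e : Sym2 V) : g ∈ edgeStab G e ↔ eact g e = e := Iff.rfl

variable {T : SimpleGraph V}

lemma eact_mem_edgeSet (hact : ActsOn T G) (g : G) {e : Sym2 V} (he : e ∈ T.edgeSet) :
    eact g e ∈ T.edgeSet := by
  induction e with | _ x y => exact hact g x y he

/-- the graph endomorphism given by `g`. -/
def gHom (hact : ActsOn T G) (g : G) : T →g T := ⟨(g • ·), fun {a b} h => hact g a b h⟩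

lemma Sep.act (hact : ActsOn T G) (g : G) {e : Sym2 V} {x y : V} (h : Sep T e x y) :
    Sep T (eact g e) (g • x) (g • y) := by
  intro p
  have hx : gHom hact g⁻¹ (g • x) = x := inv_smul_smul g x
  have hy : gHom hact g⁻¹ (g • y) = y := inv_smul_smul g y
  have h1 := h ((p.map (gHom hact g⁻¹)).copy hx hy)
  rw [SimpleGraph.Walk.edges_copy, SimpleGraph.Walk.edges_map, List.mem_map] at h1
  obtain ⟨e', he', h2⟩ := h1
  have h3 : eact g⁻¹ e' = e := h2
  rw [← h3, eact_inv']
  exact he'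

lemma sep_act_iff (hact : ActsOn T G) (g : G) {e : Sym2 V} {x y : V} :
    Sep T (eact g e) (g • x) (g • y) ↔ Sep T e x y := by
  refine ⟨fun h => ?_, fun h => h.act hact g⟩
  have := h.act hact g⁻¹
  simpa [eact_inv] using this

end

section
variable {V : Type*} {T : SimpleGraph V}

lemma not_sep_refl (e : Sym2 V) (x : V) : ¬ Sep T e x x := fun h => by
  simpa using h SimpleGraph.Walk.nil

lemma Sep.symm {e : Sym2 V} {x y : V} (h : Sep T e x y) : Sep T e y x := fun p => by
  simpa using h p.reverse

lemma not_sep_trans {e : Sym2 V} {x y z : V} (h : ¬ Sep T e x y) (h' : ¬ Sep T e y z) :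
    ¬ Sep T e x z := by
  unfold Sep at *
  push Not at *
  obtain ⟨p, hp⟩ := h
  obtain ⟨q, hq⟩ := h'
  exact ⟨p.append q, by simp [hp, hq]⟩

lemma not_sep_adj {e : Sym2 V} {x y : V} (h : T.Adj x y) (hne : s(x, y) ≠ e) :
    ¬ Sep T e x y := fun hs => by
  have := hs (SimpleGraph.Walk.cons h SimpleGraph.Walk.nil)
  simp at this
  exact hne this.symm

lemma exists_path_avoid {e : Sym2 V} {x y : V} (h : ¬ Sep T e x y) :
    ∃ p : T.Walk x y, p.IsPath ∧ e ∉ p.edges := by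
  classical
  unfold Sep at h
  push Not at h
  obtain ⟨p, hp⟩ := h
  exact ⟨p.bypass, p.bypass_isPath, fun h => hp (p.edges_bypass_subset_edges h)⟩

lemma mem_half {u v w : V} : w ∈ halfTree T u v ↔ ¬ Sep T s(u, v) v w := by
  constructor
  · rintro ⟨p, -, hp⟩ h
    exact hp (h p)
  · intro h
    exact exists_path_avoid h

lemma path_sep (hT : T.IsTree) {e : Sym2 V} {x y : V} (p : T.Walk x y) (hp : p.IsPath)
    (he : e ∈ p.edges) : Sep T e x y := by
  by_contra h
  obtain ⟨q, hq, hq'⟩ := exists_path_avoid h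
  have : p = q := congrArg Subtype.val (hT.isAcyclic.path_unique ⟨p, hp⟩ ⟨q, hq⟩)
  exact hq' (this ▸ he)

lemma sep_adj (hT : T.IsTree) {u v : V} (h : T.Adj u v) : Sep T s(u, v) u v := by
  refine path_sep hT (SimpleGraph.Walk.cons h SimpleGraph.Walk.nil) ?_ (by simp)
  simp [h.ne]

lemma sep_dich (hT : T.IsTree) (u v w : V) :
    ¬ Sep T s(u, v) u w ∨ ¬ Sep T s(u, v) v w := by
  obtain ⟨p⟩ := hT.connected.preconnected w u
  induction p with
  | nil => exact Or.inl (not_sep_refl _ _)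
  | @cons a b c hab p ih =>
    by_cases hs : s(a, b) = s(c, v)
    · rw [Sym2.eq_iff] at hs
      rcases hs with ⟨rfl, rfl⟩ | ⟨rfl, rfl⟩
      · exact Or.inl (not_sep_refl _ _)
      · exact Or.inr (not_sep_refl _ _)
    · have h1 : ¬ Sep T s(c, v) b a := fun h => not_sep_adj hab hs h.symm
      rcases ih with h | h
      · exact Or.inl (not_sep_trans h h1)
      · exact Or.inr (not_sep_trans h h1)

lemma half_iff (hT : T.IsTree) {u v : V} (h : T.Adj u v) (x y : V) :
    (x ∈ halfTree T u v ↔ y ∈ halfTree T u v) ↔ ¬ Sep T s(u, v) x y := by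
  rw [mem_half, mem_half]
  constructor
  · intro hxy
    by_cases hx : Sep T s(u, v) v x
    · have hy : Sep T s(u, v) v y := by
        by_contra hy; exact (hxy.2 hy) hx
      have hx' := (sep_dich hT u v x).resolve_right (not_not.2 hx)
      have hy' := (sep_dich hT u v y).resolve_right (not_not.2 hy)
      exact not_sep_trans (fun h => hx' h.symm) hy'
    · exact not_sep_trans (fun h => hx h.symm) (hxy.1 hx)
  · intro hxy
    constructor
    · intro hx; exact not_sep_trans hx hxy
    · intro hy; exact not_sep_trans hy (fun h => hxy h.symm)

lemma symm_half_eq {G : Type*} [Group G] [MulAction G V] (hT : T.IsTree) {u v : V}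
    (h : T.Adj u v) (x y : V) :
    XS G x (halfTree T u v) ∆ XS G y (halfTree T u v) =
      {g : G | Sep T s(u, v) (g • x) (g • y)} := by
  ext g
  have := half_iff hT h (g • x) (g • y)
  simp only [XS, Set.mem_symmDiff, Set.mem_setOf_eq]
  tauto

/-- a set is determined by its coboundary -/
lemma exists_cobdry_sep (hT : T.IsTree) (S : Set V) {x y : V} (hx : x ∈ S) (hy : y ∉ S) :
    ∃ e ∈ cobdry T S, Sep T e x y := by
  classical
  obtain ⟨p, hp⟩ := hT.connected.preconnected.exists_isPath x y
  suffices h : ∀ {x y : V} (p : T.Walk x y), x ∈ S → y ∉ S → ∃ e ∈ p.edges, e ∈ cobdry T S by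
    obtain ⟨e, he, he'⟩ := h p hx hy
    exact ⟨e, he', path_sep hT p hp he⟩
  intro x y p
  induction p with
  | nil => intro h h'; exact absurd h h'
  | @cons a b c hab p ih =>
    intro ha hc
    by_cases hb : b ∈ S
    · obtain ⟨e, he, he'⟩ := ih hb hc
      exact ⟨e, by simp [he], he'⟩
    · exact ⟨s(a, b), by simp, hab, a, b, rfl, ha, hb⟩

lemma mem_support_of_sep {u v x y : V} (h : Sep T s(u, v) x y) (p : T.Walk x y) :
    v ∈ p.support := SimpleGraph.Walk.snd_mem_support_of_mem_edges p (h p)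

lemma dist_of_sep (hT : T.IsTree) {u v x y : V} (h : Sep T s(u, v) x y) :
    T.dist x v + T.dist v y ≤ T.dist x y := by
  classical
  obtain ⟨p, hp⟩ := (hT.connected.preconnected x y).exists_walk_length_eq_dist
  have hv := mem_support_of_sep h p
  have h1 := SimpleGraph.dist_le (p.takeUntil v hv)
  have h2 := SimpleGraph.dist_le (p.dropUntil v hv)
  have h3 := congrArg SimpleGraph.Walk.length (p.take_spec hv)
  rw [SimpleGraph.Walk.length_append] at h3
  omega

lemma path_fixed {G : Type*} [Group G] [MulAction G V] (hT : T.IsTree) (hact : ActsOn T G)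
    {e : Sym2 V} {x y : V} (h : Sep T e x y) (g : G) (hx : g • x = x) (hy : g • y = y) :
    eact g e = e := by
  classical
  obtain ⟨p, hp⟩ := hT.connected.preconnected.exists_isPath x y
  have hinj : Function.Injective (gHom hact g) := MulAction.injective g
  have hx : gHom hact g x = x := hx
  have hy : gHom hact g y = y := hy
  have hq : ((p.map (gHom hact g)).copy hx hy).IsPath := by
    rw [SimpleGraph.Walk.isPath_copy]
    exact SimpleGraph.Walk.map_isPath_of_injective hinj hp
  have heq : (p.map (gHom hact g)).copy hx hy = p :=
    congrArg Subtype.val (hT.isAcyclic.path_unique ⟨_, hq⟩ ⟨p, hp⟩)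
  have h1 : p.edges.map (Sym2.map (gHom hact g)) = p.edges := by
    conv_rhs => rw [← heq]
    rw [SimpleGraph.Walk.edges_copy, SimpleGraph.Walk.edges_map]
  have h2 : ∀ l : List (Sym2 V), l.map (Sym2.map (gHom hact g)) = l →
      ∀ e ∈ l, Sym2.map (gHom hact g) e = e := by
    intro l hl e he
    obtain ⟨i, hi, rfl⟩ := List.getElem_of_mem he
    have := congrArg (fun m => m[i]?) hl
    simp [hi] at this
    exact this
  exact h2 _ h1 e (h p)

end

section
variable {G V : Type*} [Group G] [MulAction G V] {T : SimpleGraph V}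

lemma fixed_of_bounded (hT : T.IsTree) (hact : ActsOn T G) (hinv : NoInversions T G)
    (H : Subgroup G) (x : V) (N : ℕ) (hb : ∀ h ∈ H, T.dist x (h • x) ≤ N) :
    ∃ y : V, ∀ h ∈ H, h • y = y := by
  classical
  have hdle : ∀ (g : G) (a b : V), T.dist (g • a) (g • b) ≤ T.dist a b := by
    intro g a b
    obtain ⟨p, hp⟩ := (hT.connected.preconnected a b).exists_walk_length_eq_dist
    rw [← hp, ← SimpleGraph.Walk.length_map (gHom hact g) p]
    exact SimpleGraph.dist_le (p.map (gHom hact g))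
  let P : ℕ → Prop := fun n => ∃ y, ∀ h ∈ H, T.dist (h • x) y ≤ n
  have hP : ∃ n, P n := ⟨N, x, fun h hh => by rw [SimpleGraph.dist_comm]; exact hb h hh⟩
  let n := Nat.find hP
  obtain ⟨y, hy⟩ : P n := Nat.find_spec hP
  have hinvt : ∀ k ∈ H, ∀ h ∈ H, T.dist (h • x) (k • y) ≤ n := by
    intro k hk h hh
    have h1 := hdle k ((k⁻¹ * h) • x) y
    rw [← mul_smul, mul_inv_cancel_left] at h1
    exact h1.trans (hy _ (H.mul_mem (H.inv_mem hk) hh))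
  have hclose : ∀ y z : V, (∀ h ∈ H, T.dist (h • x) y ≤ n) → (∀ h ∈ H, T.dist (h • x) z ≤ n) →
      y = z ∨ T.Adj y z := by
    intro y z hy hz
    obtain ⟨p, hp⟩ := hT.connected.preconnected.exists_isPath y z
    cases p with
    | nil => exact Or.inl rfl
    | @cons _ m _ hym q =>
      by_cases hmz : m = z
      · exact Or.inr (hmz ▸ hym)
      exfalso
      have hsyz : Sep T s(y, m) y z := path_sep hT _ hp (by simp)
      have hmz' : 0 < T.dist m z := hT.connected.pos_dist_of_ne hmz
      have hym1 : 0 < T.dist m y := hT.connected.pos_dist_of_ne hym.ne'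
      have key : ∀ h ∈ H, T.dist (h • x) m + 1 ≤ n := by
        intro h hh
        rcases sep_dich hT y m (h • x) with h1 | h1
        · have h2 : Sep T s(y, m) (h • x) z := by
            by_contra h3
            exact not_sep_trans h1 h3 hsyz
          have := dist_of_sep hT h2
          have := hz h hh
          omega
        · have h2 : Sep T s(y, m) (h • x) y := by
            by_contra h3
            exact not_sep_trans h1 h3 (sep_adj hT hym).symm
          have := dist_of_sep hT h2
          have := hy h hh
          omega
      have hn : 1 ≤ n := le_trans (by omega) (key 1 H.one_mem)
      exact Nat.find_min hP (m := n - 1) (by omega)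
        ⟨m, fun h hh => by have := key h hh; omega⟩
  refine ⟨y, fun h hh => ?_⟩
  rcases hclose y (h • y) hy (hinvt h hh) with h1 | h1
  · exact h1.symm
  · exfalso
    rcases hclose y ((h * h) • y) hy (hinvt _ (H.mul_mem hh hh)) with h2 | h2
    · exact hinv h y (h • y) h1 ⟨rfl, by rw [← mul_smul]; exact h2.symm⟩
    · have h3 : T.Adj (h • y) ((h * h) • y) := by
        rw [mul_smul]; exact hact h _ _ h1
      rcases hclose (h • y) y (hinvt h hh) hy with h4 | h4
      · exact h1.ne h4.symm
      · -- triangle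
        have hs := sep_adj hT h1
        have h5 : ¬ Sep T s(y, h • y) y ((h * h) • y) :=
          not_sep_adj h2 (by
            intro h6
            rw [Sym2.eq_iff] at h6
            rcases h6 with ⟨-, h6⟩ | ⟨h6, -⟩
            · exact h3.ne h6.symm
            · exact h1.ne h6)
        have h6 : ¬ Sep T s(y, h • y) ((h * h) • y) (h • y) :=
          not_sep_adj h3.symm (by
            intro h6
            rw [Sym2.eq_iff] at h6
            rcases h6 with ⟨h6, -⟩ | ⟨h6, -⟩
            · exact h2.ne h6.symm
            · exact h3.ne h6.symm)
        exact not_sep_trans h5 h6 hs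

end

section
variable {G : Type*} [Group G]

lemma hfin_iff (H : Subgroup G) (X : Set G) :
    HFin H X ↔ ∃ F : Finset G, ∀ x ∈ X, ∃ f ∈ F, x * f⁻¹ ∈ H := by
  unfold HFin
  refine exists_congr fun F => ?_
  constructor
  · intro h x hx
    have := h hx
    simp only [Set.mem_iUnion, Set.mem_image] at this
    obtain ⟨f, hf, k, hk, rfl⟩ := this
    exact ⟨f, hf, by simpa using hk⟩
  · intro h x hx
    obtain ⟨f, hf, hk⟩ := h x hx
    simp only [Set.mem_iUnion, Set.mem_image]
    exact ⟨f, hf, _, hk, by simp⟩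

lemma HFin.mono {H : Subgroup G} {X Y : Set G} (h : HFin H Y) (hs : X ⊆ Y) : HFin H X := by
  obtain ⟨F, hF⟩ := h
  exact ⟨F, hs.trans hF⟩

lemma HFin.union {H : Subgroup G} {X Y : Set G} (h : HFin H X) (h' : HFin H Y) :
    HFin H (X ∪ Y) := by
  classical
  rw [hfin_iff] at *
  obtain ⟨F, hF⟩ := h
  obtain ⟨F', hF'⟩ := h'
  refine ⟨F ∪ F', ?_⟩
  rintro x (hx | hx)
  · obtain ⟨f, hf, h⟩ := hF x hx; exact ⟨f, by simp [hf], h⟩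
  · obtain ⟨f, hf, h⟩ := hF' x hx; exact ⟨f, by simp [hf], h⟩

lemma HFin.mul_right {H : Subgroup G} {X : Set G} (h : HFin H X) (s : G) :
    HFin H {g | g * s ∈ X} := by
  classical
  rw [hfin_iff] at *
  obtain ⟨F, hF⟩ := h
  refine ⟨F.image (· * s⁻¹), ?_⟩
  intro x hx
  obtain ⟨f, hf, h⟩ := hF _ hx
  exact ⟨f * s⁻¹, Finset.mem_image_of_mem _ hf, by simpa [mul_assoc] using h⟩

lemma cosets_of_relIndex {H K : Subgroup G} (h : H.relIndex K ≠ 0) :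
    ∃ R : Finset G, ∀ k ∈ K, ∃ r ∈ R, r ∈ K ∧ r⁻¹ * k ∈ H := by
  classical
  have : (H.subgroupOf K).FiniteIndex := ⟨h⟩
  have : Finite (K ⧸ H.subgroupOf K) := inferInstance
  have := Fintype.ofFinite (K ⧸ H.subgroupOf K)
  refine ⟨Finset.univ.image fun q : K ⧸ H.subgroupOf K => ((q.out : K) : G), fun k hk => ?_⟩
  refine ⟨_, Finset.mem_image_of_mem _ (Finset.mem_univ (QuotientGroup.mk ⟨k, hk⟩)), ?_, ?_⟩
  · exact SetLike.coe_mem _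
  · have := QuotientGroup.out_eq' (QuotientGroup.mk (s := H.subgroupOf K) ⟨k, hk⟩)
    rw [QuotientGroup.eq, Subgroup.mem_subgroupOf] at this
    exact this

lemma relIndex_of_cosets {H K : Subgroup G} (R : Finset G)
    (h : ∀ k ∈ K, ∃ r ∈ R, k * r⁻¹ ∈ H) : H.relIndex K ≠ 0 := by
  classical
  have hfin : Finite (K ⧸ H.subgroupOf K) := by
    choose! r hr hr' using h
    refine Finite.of_injective
      (fun q : K ⧸ H.subgroupOf K => (⟨r ((q.out : K) : G)⁻¹, hr _ (K.inv_mem (SetLike.coe_mem _))⟩ : R)) ?_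
    intro q q' hqq
    have h0 : r ((q.out : K) : G)⁻¹ = r ((q'.out : K) : G)⁻¹ := by simpa using hqq
    have h1 := hr' ((q.out : K) : G)⁻¹ (K.inv_mem (SetLike.coe_mem _))
    have h2 := hr' ((q'.out : K) : G)⁻¹ (K.inv_mem (SetLike.coe_mem _))
    rw [← h0] at h2
    have h3 := H.mul_mem h1 (H.inv_mem h2)
    rw [← QuotientGroup.out_eq' q, ← QuotientGroup.out_eq' q', QuotientGroup.eq,
      Subgroup.mem_subgroupOf]
    simpa [mul_assoc] using h3
  exact Subgroup.index_ne_zero_of_finite (H := H.subgroupOf K)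

lemma HFin.change {H K : Subgroup G} {X : Set G} (h : HFin K X) (hr : H.relIndex K ≠ 0) :
    HFin H X := by
  classical
  rw [hfin_iff] at *
  obtain ⟨F, hF⟩ := h
  obtain ⟨R, hR⟩ := cosets_of_relIndex hr
  refine ⟨(R ×ˢ F).image fun p => p.1⁻¹ * p.2, fun x hx => ?_⟩
  obtain ⟨f, hf, hk⟩ := hF x hx
  obtain ⟨r, hr, -, hrk⟩ := hR _ (K.inv_mem hk)
  refine ⟨r⁻¹ * f, Finset.mem_image.2 ⟨(r, f), by simp [hr, hf], rfl⟩, ?_⟩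
  have := H.inv_mem hrk
  simpa [mul_assoc] using this

/-- Boolean combinations. -/
lemma bool_mem {α : Type*} (A : Set (Set α)) (hne : A.Nonempty) (hc : ∀ X ∈ A, Xᶜ ∈ A)
    (hi : ∀ X ∈ A, ∀ X' ∈ A, X ∩ X' ∈ A) (F : Finset (Set α)) (hF : ∀ X ∈ F, X ∈ A) :
    ∀ S : Set α, (∀ x ∈ S, ∀ y, (∀ X ∈ F, x ∈ X ↔ y ∈ X) → y ∈ S) → S ∈ A := by
  classical
  have hu : ∀ X ∈ A, ∀ X' ∈ A, X ∪ X' ∈ A := by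
    intro X hX X' hX'
    have := hc _ (hi _ (hc X hX) _ (hc X' hX'))
    rwa [← Set.compl_union, compl_compl] at this
  induction F using Finset.induction_on with
  | empty =>
    intro S hS
    obtain ⟨X, hX⟩ := hne
    have huniv : Set.univ ∈ A := by
      have := hu X hX _ (hc X hX)
      rwa [Set.union_compl_self] at this
    rcases S.eq_empty_or_nonempty with rfl | ⟨x, hx⟩
    · have := hc _ huniv
      rwa [Set.compl_univ] at this
    · have : S = Set.univ := Set.eq_univ_of_forall fun y => hS x hx y (by simp)
      rw [this]; exact huniv
  | insert B F hB ih =>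
    intro S hS
    have hBA : B ∈ A := hF B (by simp)
    have ih' := ih (fun X hX => hF X (by simp [hX]))
    have h1 := ih' {x | ∃ y ∈ S, y ∈ B ∧ ∀ X ∈ F, y ∈ X ↔ x ∈ X} (by
      rintro x ⟨y, hy, hyB, h⟩ z hz
      exact ⟨y, hy, hyB, fun X hX => (h X hX).trans (hz X hX)⟩)
    have h2 := ih' {x | ∃ y ∈ S, y ∉ B ∧ ∀ X ∈ F, y ∈ X ↔ x ∈ X} (by
      rintro x ⟨y, hy, hyB, h⟩ z hz
      exact ⟨y, hy, hyB, fun X hX => (h X hX).trans (hz X hX)⟩)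
    have h3 := hu _ (hi _ hBA _ h1) _ (hi _ (hc _ hBA) _ h2)
    convert h3 using 1
    ext x
    constructor
    · intro hx
      by_cases hxB : x ∈ B
      · exact Or.inl ⟨hxB, x, hx, hxB, fun _ _ => Iff.rfl⟩
      · exact Or.inr ⟨hxB, x, hx, hxB, fun _ _ => Iff.rfl⟩
    · rintro (⟨hxB, y, hy, hyB, h⟩ | ⟨hxB, y, hy, hyB, h⟩)
      · refine hS y hy x fun X hX => ?_
        rcases Finset.mem_insert.1 hX with rfl | hX
        · exact ⟨fun _ => hxB, fun _ => hyB⟩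
        · exact h X hX
      · refine hS y hy x fun X hX => ?_
        rcases Finset.mem_insert.1 hX with rfl | hX
        · exact ⟨fun h => absurd h hyB, fun h => absurd h hxB⟩
        · exact h X hX

end

section
variable {G V : Type*} [Group G] [MulAction G V] {T : SimpleGraph V}

lemma hfin_sep (hT : T.IsTree) (hact : ActsOn T G) (e : Sym2 V) (x y : V) :
    HFin (edgeStab G e) {g : G | Sep T e (g • x) (g • y)} := by
  classical
  rw [hfin_iff]
  obtain ⟨p⟩ := hT.connected.preconnected x y
  have : ∀ c : Sym2 V, ∃ f : G, ∀ g : G, eact g⁻¹ e = c → eact f⁻¹ e = c := by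
    intro c
    by_cases h : ∃ g : G, eact g⁻¹ e = c
    · obtain ⟨g, hg⟩ := h; exact ⟨g, fun _ _ => hg⟩
    · push Not at h; exact ⟨1, fun g hg => absurd hg (h g)⟩
  choose f hf using this
  refine ⟨(p.edges.map f).toFinset, fun g hg => ?_⟩
  have h1 : Sep T (eact g⁻¹ e) x y := by
    have := Sep.act hact g⁻¹ hg
    simpa using this
  refine ⟨f (eact g⁻¹ e), by simpa using ⟨_, h1 p, rfl⟩, ?_⟩
  rw [mem_edgeStab, eact_mul, hf _ g rfl, eact_inv']

lemma half_act (hact : ActsOn T G) (g : G) {u v w : V} :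
    g • w ∈ halfTree T (g • u) (g • v) ↔ w ∈ halfTree T u v := by
  rw [mem_half, mem_half, ← eact_mk, sep_act_iff hact]

lemma orbit_not_half (hT : T.IsTree) (hact : ActsOn T G) (hmin : MinimalAction T G) (x : V)
    {u v : V} (huv : T.Adj u v) : ∃ g : G, g • x ∉ halfTree T u v := by
  by_contra hcon
  push Not at hcon
  have := hmin {w | ∀ u v, T.Adj u v → (∀ g : G, g • x ∈ halfTree T u v) → w ∈ halfTree T u v}
    ⟨x, fun u v _ h => by simpa using h 1⟩ ?_ ?_
  · have h1 : u ∈ halfTree T u v := by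
      have h2 : u ∈ (Set.univ : Set V) := Set.mem_univ u
      rw [← this] at h2
      exact h2 u v huv hcon
    exact mem_half.1 h1 (sep_adj hT huv).symm
  · intro g a ha u v huv h
    have := ha (g⁻¹ • u) (g⁻¹ • v) (hact _ _ _ huv) (fun k => by
      have := (half_act hact g⁻¹).2 (h (g * k))
      rwa [← mul_smul, inv_mul_cancel_left] at this)
    have := (half_act hact g).2 this
    simpa using this
  · intro a ha b hb w hw u v huv h
    have ha' := ha u v huv h
    have hb' := hb u v huv h
    have h1 := (half_iff hT huv a b).1 (by tauto)
    obtain ⟨p, hp, hpe⟩ := exists_path_avoid h1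
    have hwp := hw p hp
    classical
    have h2 : ¬ Sep T s(u, v) a w := fun h =>
      hpe (p.edges_takeUntil_subset_edges hwp (h (p.takeUntil w hwp)))
    exact ((half_iff hT huv a w).2 h2).1 ha'

lemma orbit_half (hT : T.IsTree) (hact : ActsOn T G) (hmin : MinimalAction T G) (x : V)
    {u v : V} (huv : T.Adj u v) : ∃ g : G, g • x ∈ halfTree T u v := by
  obtain ⟨g, hg⟩ := orbit_not_half hT hact hmin x huv.symm
  rw [mem_half, not_not, Sym2.eq_swap] at hg
  exact ⟨g, mem_half.2 ((sep_dich hT u v (g • x)).resolve_left (not_not.2 hg))⟩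

lemma finEdgeOrbits (hG : Group.FG G) (hT : T.IsTree) (hact : ActsOn T G)
    (hmin : MinimalAction T G) (x : V) : FinEdgeOrbits T G := by
  classical
  obtain ⟨S, hS⟩ := hG.out
  let p' : ∀ s : G, T.Walk x (s • x) := fun s => (hT.connected.preconnected x (s • x)).some
  refine ⟨S.biUnion fun s => (p' s).edges.toFinset, fun e he => ?_⟩
  induction e with | _ u v =>
  have huv : T.Adj u v := he
  obtain ⟨g, s, hs, hgs⟩ : ∃ g : G, ∃ s ∈ S, Sep T s(u, v) (g • x) ((g * s) • x) := by
    by_contra hcon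
    push Not at hcon
    have h1 : ∀ k ∈ Subgroup.closure (S : Set G), ∀ g : G,
        ¬ Sep T s(u, v) (g • x) ((g * k) • x) := by
      intro k hk
      induction hk using Subgroup.closure_induction with
      | mem k hk => exact fun g => hcon g k hk
      | one => intro g; simpa using not_sep_refl _ _
      | mul a b _ _ ha hb =>
        intro g
        have := not_sep_trans (ha g) (hb (g * a))
        rwa [mul_assoc] at this
      | inv a _ ha =>
        intro g h
        have := ha (g * a⁻¹)
        rw [inv_mul_cancel_right] at this
        exact this h.symm
    obtain ⟨g, hg⟩ := orbit_half hT hact hmin x huv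
    obtain ⟨g', hg'⟩ := orbit_not_half hT hact hmin x huv
    have := h1 (g⁻¹ * g') (by rw [hS]; trivial) g
    rw [mul_inv_cancel_left] at this
    exact hg' (((half_iff hT huv _ _).2 this).1 hg)
  have h2 : Sep T (eact g⁻¹ s(u, v)) x (s • x) := by
    have := Sep.act hact g⁻¹ hgs
    rwa [inv_smul_smul, mul_smul, inv_smul_smul] at this
  refine ⟨eact g⁻¹ s(u, v), ?_, g, eact_inv' g _⟩
  simp only [Finset.mem_biUnion, List.mem_toFinset]
  exact ⟨s, hs, h2 _⟩

end

section
variable {G V : Type*} [Group G] [MulAction G V] {T : SimpleGraph V}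

lemma fix_of_edgeStab (hinv : NoInversions T G) {u v : V} (huv : T.Adj u v) {g : G}
    (hg : g ∈ edgeStab G s(u, v)) : g • u = u ∧ g • v = v := by
  rw [mem_edgeStab, eact_mk, Sym2.eq_iff] at hg
  rcases hg with h | h
  · exact h
  · exact absurd h (hinv g u v huv)

lemma bct_ze {v₀ : V} {Y : Set (Sym2 V)} {H : Subgroup G} {u v : V} (h : T.Adj u v)
    (hY : s(u, v) ∈ Y) : Ze T G v₀ u v ∈ BCT T v₀ Y H := by
  rw [BCT, Set.mem_sInter]
  exact fun F hF => hF.1 u v h hY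

lemma bct_compl {v₀ : V} {Y : Set (Sym2 V)} {H : Subgroup G} :
    ∀ X ∈ BCT T v₀ Y H, Xᶜ ∈ BCT T v₀ Y H := by
  intro X hX
  rw [BCT, Set.mem_sInter] at *
  exact fun F hF => hF.2.1 X (hX F hF)

lemma bct_inter {v₀ : V} {Y : Set (Sym2 V)} {H : Subgroup G} :
    ∀ X ∈ BCT T v₀ Y H, ∀ X' ∈ BCT T v₀ Y H, X ∩ X' ∈ BCT T v₀ Y H := by
  intro X hX X' hX'
  rw [BCT, Set.mem_sInter] at *
  exact fun F hF => hF.2.2.1 X (hX F hF) X' (hX' F hF)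

lemma bct_equiv {v₀ : V} {Y : Set (Sym2 V)} {H : Subgroup G} :
    ∀ X ∈ BCT T v₀ Y H, ∀ X' : Set G, HFin H (X ∆ X') → X' ∈ BCT T v₀ Y H := by
  intro X hX X' hX'
  rw [BCT, Set.mem_sInter] at *
  exact fun F hF => hF.2.2.2 X (hX F hF) X' hX'

lemma bct_ind {v₀ : V} {Y : Set (Sym2 V)} {H : Subgroup G} {X : Set G}
    (hX : X ∈ BCT T v₀ Y H) (F : Set (Set G))
    (h1 : ∀ u v : V, T.Adj u v → s(u, v) ∈ Y → Ze T G v₀ u v ∈ F)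
    (h2 : ∀ X ∈ F, Xᶜ ∈ F)
    (h3 : ∀ X ∈ F, ∀ X' ∈ F, X ∩ X' ∈ F)
    (h4 : ∀ X ∈ F, ∀ X' : Set G, HFin H (X ∆ X') → X' ∈ F) : X ∈ F := by
  rw [BCT, Set.mem_sInter] at hX
  exact hX F ⟨h1, h2, h3, h4⟩

lemma forest_mem (hT : T.IsTree) {v₀ : V} {Y : Set (Sym2 V)} (hYn : Y.Nonempty)
    (hYe : Y ⊆ T.edgeSet) (H : Subgroup G) (S : Set V) (hfin : (cobdry T S).Finite)
    (hS : cobdry T S ⊆ Y) : XS G v₀ S ∈ BCT T v₀ Y H := by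
  classical
  have hex : ∀ e : Sym2 V, ∃ q : V × V, e = s(q.1, q.2) := by
    intro e
    induction e with | _ u v => exact ⟨(u, v), rfl⟩
  choose q hq using hex
  have hze : ∀ e ∈ Y, Ze T G v₀ (q e).1 (q e).2 ∈ BCT T v₀ Y H := by
    intro e he
    refine bct_ze ?_ ?_
    · have := hYe he
      rw [hq e] at this
      exact this
    · rw [← hq e]; exact he
  refine bool_mem (BCT T v₀ Y H) ?_ bct_compl bct_inter
    (hfin.toFinset.image fun e => Ze T G v₀ (q e).1 (q e).2) ?_ _ ?_
  · obtain ⟨e, he⟩ := hYn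
    exact ⟨_, hze e he⟩
  · intro X hX
    obtain ⟨e, he, rfl⟩ := Finset.mem_image.1 hX
    exact hze e (hS (by simpa using he))
  · intro x hx y hxy
    by_contra hy
    obtain ⟨e, he, hsep⟩ := exists_cobdry_sep hT S hx hy
    have h1 := hxy _ (Finset.mem_image_of_mem _ (hfin.mem_toFinset.2 he))
    have hadj : T.Adj (q e).1 (q e).2 := by
      have := he.1
      rw [hq e] at this
      exact this
    have h2 := (half_iff hT hadj (x • v₀) (y • v₀)).1 h1
    rw [← hq e] at h2
    exact h2 hsep

end

section
variable {G V V' : Type*} [Group G] [MulAction G V] [MulAction G V']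
  {T : SimpleGraph V} {T' : SimpleGraph V'} {E : Set (Subgroup G)}

lemma commens_of_le (hE : Admissible E) {A B : Subgroup G} (hA : A ∈ E) (hB : B ∈ E)
    (h : A ≤ B) : Subgroup.Commensurable A B := by
  refine ⟨hE.2.2 A hA B hB h, ?_⟩
  rw [Subgroup.relIndex_eq_one.2 h]
  exact one_ne_zero

lemma forward_cobdry (hT' : T'.IsTree)
    (hact' : ActsOn T' G) (hinv : NoInversions T G)
    (hE : Admissible E) (hET : IsETree T G E) (hET' : IsETree T' G E)
    (f : V → V') (hf : ∀ (g : G) (x : V), f (g • x) = g • f x) {u v : V'} (huv : T'.Adj u v)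
    (ε : Sym2 V) (hε : ε ∈ cobdry T (f ⁻¹' halfTree T' u v)) :
    Subgroup.Commensurable (edgeStab G ε) (edgeStab G s(u, v)) := by
  obtain ⟨he, a, b, rfl, ha, hb⟩ := hε
  refine commens_of_le hE (hET _ he) (hET' _ huv) ?_
  intro g hg
  obtain ⟨hga, hgb⟩ := fix_of_edgeStab hinv he hg
  have hsep : Sep T' s(u, v) (f a) (f b) := by
    by_contra h
    exact hb (((half_iff hT' huv _ _).2 h).1 ha)
  exact path_fixed hT' hact' hsep g (by rw [← hf, hga]) (by rw [← hf, hgb])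

lemma forward_finite (hT' : T'.IsTree)
    (hact' : ActsOn T' G) (hinv : NoInversions T G)
    (hE : Admissible E) (hET : IsETree T G E) (hET' : IsETree T' G E)
    (hfo : FinEdgeOrbits T G)
    (f : V → V') (hf : ∀ (g : G) (x : V), f (g • x) = g • f x) {u v : V'} (huv : T'.Adj u v) :
    (cobdry T (f ⁻¹' halfTree T' u v)).Finite := by
  classical
  obtain ⟨F, hF⟩ := hfo
  have hcom := forward_cobdry hT' hact' hinv hE hET hET' f hf huv
  have h1 : ∀ e₀ : Sym2 V,
      {ε | ε ∈ cobdry T (f ⁻¹' halfTree T' u v) ∧ ∃ g : G, eact g e₀ = ε}.Finite := by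
    intro e₀
    induction e₀ with | _ a b =>
    have h2 := hfin_sep (G := G) hT' hact' s(u, v) (f a) (f b)
    rw [hfin_iff] at h2
    obtain ⟨F₁, hF₁⟩ := h2
    have h3 : ∀ f₁ : G, {ε | ε ∈ cobdry T (f ⁻¹' halfTree T' u v) ∧
        ∃ k ∈ edgeStab G s(u, v), eact k (eact f₁ s(a, b)) = ε}.Finite := by
      intro f₁
      rcases Set.eq_empty_or_nonempty {ε | ε ∈ cobdry T (f ⁻¹' halfTree T' u v) ∧
        ∃ k ∈ edgeStab G s(u, v), eact k (eact f₁ s(a, b)) = ε} with h | ⟨ε₁, h4, k₁, hk₁, h5⟩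
      · rw [h]; exact Set.finite_empty
      · obtain ⟨R, hR⟩ := cosets_of_relIndex (hcom ε₁ h4).1
        refine (R.finite_toSet.image fun r => eact r ε₁).subset ?_
        rintro ε ⟨-, k, hk, rfl⟩
        obtain ⟨r, hr, -, hrk⟩ := hR (k * k₁⁻¹) (mul_mem hk (inv_mem hk₁))
        refine ⟨r, hr, ?_⟩
        rw [mem_edgeStab, eact_mul, eact_mul, ← h5, eact_inv] at hrk
        show eact r ε₁ = _
        rw [← h5, ← hrk, eact_inv']
    refine (F₁.finite_toSet.biUnion fun f₁ _ => h3 f₁).subset ?_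
    rintro ε ⟨hε, g, rfl⟩
    have hsep : Sep T' s(u, v) (g • f a) (g • f b) := by
      obtain ⟨-, c, d, hcd, hc, hd⟩ := hε
      have h6 : Sep T' s(u, v) (f c) (f d) := by
        by_contra h
        exact hd (((half_iff hT' huv _ _).2 h).1 hc)
      rw [eact_mk, Sym2.eq_iff] at hcd
      rw [← hf, ← hf]
      rcases hcd with ⟨h7, h8⟩ | ⟨h7, h8⟩
      · rw [h7, h8]; exact h6
      · rw [h7, h8]; exact h6.symm
    obtain ⟨f₁, hf₁, hk⟩ := hF₁ g hsep
    refine Set.mem_biUnion hf₁ ⟨hε, _, hk, ?_⟩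
    rw [← eact_mul, inv_mul_cancel_right]
  refine (F.finite_toSet.biUnion fun e₀ _ => h1 e₀).subset ?_
  intro ε hε
  obtain ⟨e₀, he₀, g, hg⟩ := hF ε hε.1
  exact Set.mem_biUnion he₀ ⟨hε, g, hg⟩

lemma forward (hGfg : Group.FG G)
    (hT : T.IsTree) (hT' : T'.IsTree)
    (hact : ActsOn T G) (hact' : ActsOn T' G)
    (hinv : NoInversions T G)
    (hE : Admissible E)
    (hET : IsETree T G E) (hET' : IsETree T' G E)
    (hmin : MinimalAction T G) (hmin' : MinimalAction T' G)
    (v₀ : V) (v₀' : V') (hdom : Dominates G T T') : BT T' G v₀' ⊆ BT T G v₀ := by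
  obtain ⟨f, hf⟩ := hdom
  have hfo := finEdgeOrbits hGfg hT hact hmin v₀
  rintro X ⟨Y', hY', e', he', hX⟩
  have hne : ∃ ε₀ ∈ T.edgeSet, Subgroup.Commensurable (edgeStab G ε₀) (edgeStab G e') := by
    have he := hY'.2.1 he'
    induction e' with | _ u v =>
    have huv : T'.Adj u v := he
    obtain ⟨g, hg⟩ := orbit_half hT' hact' hmin' (f v₀) huv
    obtain ⟨g', hg'⟩ := orbit_not_half hT' hact' hmin' (f v₀) huv
    rw [← hf] at hg hg'
    obtain ⟨ε, hε, -⟩ := exists_cobdry_sep hT (f ⁻¹' halfTree T' u v) hg hg'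
    exact ⟨ε, hε.1, forward_cobdry hT' hact' hinv hE hET hET' f hf huv ε hε⟩
  obtain ⟨ε₀, hε₀, hc₀⟩ := hne
  let Y : Set (Sym2 V) := {ε | ε ∈ T.edgeSet ∧
    Subgroup.Commensurable (edgeStab G ε) (edgeStab G e')}
  have hYn : Y.Nonempty := ⟨ε₀, hε₀, hc₀⟩
  refine ⟨Y, ⟨hYn, fun ε h => h.1, ?_⟩, ε₀, ⟨hε₀, hc₀⟩, ?_⟩
  · intro ε hε ε' hε'
    constructor
    · intro h; exact hε.2.trans h.2.symm
    · intro h; exact ⟨hε', h.symm.trans hε.2⟩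
  · refine bct_ind hX _ ?_ bct_compl bct_inter ?_
    · intro u v huv huvY
      have hce : Subgroup.Commensurable (edgeStab G e') (edgeStab G s(u, v)) :=
        (hY'.2.2 e' he' _ huv).1 huvY
      refine bct_equiv (XS G v₀ (f ⁻¹' halfTree T' u v)) ?_ _ ?_
      · refine forest_mem hT hYn (fun ε h => h.1) _ _
          (forward_finite hT' hact' hinv hE hET hET' hfo f hf huv) ?_
        intro ε hε
        exact ⟨hε.1, (forward_cobdry hT' hact' hinv hE hET hET' f hf huv ε hε).trans hce.symm⟩
      · have h1 : XS G v₀ (f ⁻¹' halfTree T' u v) = XS G (f v₀) (halfTree T' u v) := by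
          ext g
          show f (g • v₀) ∈ halfTree T' u v ↔ g • f v₀ ∈ halfTree T' u v
          rw [hf]
        rw [h1, Ze, symm_half_eq hT' huv]
        exact (hfin_sep hT' hact' _ _ _).change (hc₀.trans hce).1
    · intro X hX X' h
      exact bct_equiv X hX X' (h.change hc₀.1)

lemma backward_edge
    (hT : T.IsTree) (hT' : T'.IsTree)
    (hact : ActsOn T G) (hact' : ActsOn T' G)
    (hinv' : NoInversions T' G)
    (hE : Admissible E)
    (hET : IsETree T G E) (hET' : IsETree T' G E)
    (hmin' : MinimalAction T' G)
    (v₀ : V) (v₀' : V') (hB : BT T' G v₀' ⊆ BT T G v₀) {u v : V'} (huv : T'.Adj u v) (x : V) :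
    ∃ S : Set V, HFin (edgeStab G s(u, v)) (Ze T' G v₀' u v ∆ XS G x S) := by
  have hZ : Ze T' G v₀' u v ∈ BT T' G v₀' := by
    refine ⟨{e | e ∈ T'.edgeSet ∧ Subgroup.Commensurable (edgeStab G e) (edgeStab G s(u, v))},
      ⟨⟨s(u, v), huv, Subgroup.Commensurable.refl _⟩, fun e h => h.1, ?_⟩,
      s(u, v), ⟨huv, Subgroup.Commensurable.refl _⟩,
      bct_ze huv ⟨huv, Subgroup.Commensurable.refl _⟩⟩
    intro ε hε ε' hε'
    constructor
    · intro h; exact hε.2.trans h.2.symm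
    · intro h; exact ⟨hε', h.symm.trans hε.2⟩
  obtain ⟨Y, hY, e, he, hX⟩ := hB hZ
  have hedge : ∀ u v : V, T.Adj u v → s(u, v) ∈ Y → ∀ x y : V,
      HFin (edgeStab G e) (XS G x (halfTree T u v) ∆ XS G y (halfTree T u v)) := by
    intro u v huv huvY x y
    rw [symm_half_eq hT huv]
    exact (hfin_sep hT hact _ _ _).change ((hY.2.2 e he _ huv).1 huvY).1
  have hF1 : ∃ S : Set V, HFin (edgeStab G e) (Ze T' G v₀' u v ∆ XS G x S) := by
    refine bct_ind hX {X | ∃ S : Set V, HFin (edgeStab G e) (X ∆ XS G x S)} ?_ ?_ ?_ ?_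
    · intro u v huv huvY
      exact ⟨halfTree T u v, hedge u v huv huvY _ _⟩
    · rintro X ⟨S, hS⟩
      refine ⟨Sᶜ, hS.mono ?_⟩
      have : XS G x Sᶜ = (XS G x S)ᶜ := rfl
      rw [this, compl_symmDiff_compl]
    · rintro X ⟨S, hS⟩ X' ⟨S', hS'⟩
      refine ⟨S ∩ S', (hS.union hS').mono ?_⟩
      intro g hg
      have : g ∈ XS G x (S ∩ S') ↔ g ∈ XS G x S ∧ g ∈ XS G x S' := Iff.rfl
      simp only [Set.mem_symmDiff, Set.mem_union, Set.mem_inter_iff, this] at *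
      tauto
    · rintro X ⟨S, hS⟩ X' h
      refine ⟨S, (hS.union h).mono ?_⟩
      intro g hg
      simp only [Set.mem_symmDiff, Set.mem_union] at *
      tauto
  have hF2 : ∀ s : G, HFin (edgeStab G e)
      (Ze T' G v₀' u v ∆ {g | g * s ∈ Ze T' G v₀' u v}) := by
    intro s
    refine bct_ind hX {X | HFin (edgeStab G e) (X ∆ {g | g * s ∈ X})} ?_ ?_ ?_ ?_
    · intro u v huv huvY
      refine (hedge u v huv huvY v₀ (s • v₀)).mono ?_
      intro g hg
      have : ∀ g : G, g ∈ Ze T G v₀ u v ↔ g • v₀ ∈ halfTree T u v := fun _ => Iff.rfl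
      have h2 : ∀ y (g : G), g ∈ XS G y (halfTree T u v) ↔ g • y ∈ halfTree T u v :=
        fun _ _ => Iff.rfl
      have h3 : g ∈ {g | g * s ∈ Ze T G v₀ u v} ↔ g • s • v₀ ∈ halfTree T u v := by
        rw [← mul_smul]; rfl
      rw [Set.mem_symmDiff, h3, this] at hg
      rw [Set.mem_symmDiff, h2, h2]
      exact hg
    · intro X h
      show HFin _ (Xᶜ ∆ {g | g * s ∈ X}ᶜ)
      rw [compl_symmDiff_compl]
      exact h
    · intro X h X' h'
      refine (HFin.union h h').mono ?_
      intro g hg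
      have : g ∈ {g | g * s ∈ X ∩ X'} ↔ g ∈ {g | g * s ∈ X} ∧ g ∈ {g | g * s ∈ X'} := Iff.rfl
      simp only [Set.mem_symmDiff, Set.mem_union, Set.mem_inter_iff, this] at *
      tauto
    · intro X h X' h'
      refine ((HFin.union h h').union (h'.mul_right s)).mono ?_
      intro g hg
      have : g ∈ {g | g * s ∈ X ∆ X'} ↔ g * s ∈ X ∆ X' := Iff.rfl
      have h1 : g ∈ {g | g * s ∈ X} ↔ g * s ∈ X := Iff.rfl
      have h2 : g ∈ {g | g * s ∈ X'} ↔ g * s ∈ X' := Iff.rfl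
      simp only [Set.mem_symmDiff, Set.mem_union, this, h1, h2] at *
      tauto
  have hrel : (edgeStab G e).relIndex (edgeStab G s(u, v)) ≠ 0 := by
    classical
    obtain ⟨g, hg⟩ := orbit_half (G := G) hT' hact' hmin' v₀' huv
    obtain ⟨g', hg'⟩ := orbit_not_half (G := G) hT' hact' hmin' v₀' huv
    have h1 := hF2 (g⁻¹ * g')
    rw [hfin_iff] at h1
    obtain ⟨R, hR⟩ := h1
    refine relIndex_of_cosets (R.image fun r => r * g⁻¹) ?_
    intro k hk
    obtain ⟨hku, hkv⟩ := fix_of_edgeStab hinv' huv hk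
    have hkh : ∀ w, k • w ∈ halfTree T' u v ↔ w ∈ halfTree T' u v := by
      intro w
      have := half_act hact' k (u := u) (v := v) (w := w)
      rwa [hku, hkv] at this
    obtain ⟨r, hr, hkr⟩ := hR (k * g) (by
      refine Or.inl ⟨?_, ?_⟩
      · show (k * g) • v₀' ∈ halfTree T' u v
        rw [mul_smul, hkh]; exact hg
      · show ¬ ((k * g) * (g⁻¹ * g')) • v₀' ∈ halfTree T' u v
        have : (k * g) * (g⁻¹ * g') = k * g' := by group
        rw [this, mul_smul, hkh]; exact hg')
    exact ⟨r * g⁻¹, Finset.mem_image_of_mem _ hr, by simpa [mul_assoc] using hkr⟩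
  have hrel' : (edgeStab G s(u, v)).relIndex (edgeStab G e) ≠ 0 := by
    have hA : edgeStab G e ⊓ edgeStab G s(u, v) ∈ E := by
      refine hE.2.1 (edgeStab G s(u, v)) (hET' s(u, v) huv) _ ⟨?_, ?_⟩
      · rw [Subgroup.inf_relIndex_right]; exact hrel
      · rw [Subgroup.relIndex_eq_one.2 inf_le_right]; exact one_ne_zero
    have := hE.2.2 _ hA _ (hET _ (hY.2.1 he)) inf_le_left
    rwa [Subgroup.inf_relIndex_left] at this
  obtain ⟨S, hS⟩ := hF1
  exact ⟨S, hS.change hrel'⟩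

lemma backward (hGfg : Group.FG G)
    (hT : T.IsTree) (hT' : T'.IsTree)
    (hact : ActsOn T G) (hact' : ActsOn T' G)
    (hinv' : NoInversions T' G)
    (hE : Admissible E)
    (hET : IsETree T G E) (hET' : IsETree T' G E)
    (hmin' : MinimalAction T' G)
    (v₀ : V) (v₀' : V') (hB : BT T' G v₀' ⊆ BT T G v₀) : Dominates G T T' := by
  classical
  have hell : ∀ x : V, ∃ y : V', ∀ h ∈ MulAction.stabilizer G x, h • y = y := by
    intro x
    obtain ⟨F, hF⟩ := finEdgeOrbits (T := T') hGfg hT' hact' hmin' v₀'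
    have hex : ∀ e : Sym2 V', ∃ R : Finset G, e ∈ T'.edgeSet → ∀ g h : G,
        h ∈ MulAction.stabilizer G x → Sep T' e (g • v₀') ((g * h) • v₀') →
        ∃ r ∈ R, g * r⁻¹ ∈ edgeStab G e ∨ g * h * r⁻¹ ∈ edgeStab G e := by
      intro e
      by_cases he : e ∈ T'.edgeSet
      · induction e with | _ u v =>
        have huv : T'.Adj u v := he
        obtain ⟨S, hS⟩ := backward_edge hT hT' hact hact' hinv' hE hET hET' hmin' v₀ v₀' hB huv x
        rw [hfin_iff] at hS
        obtain ⟨R, hR⟩ := hS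
        refine ⟨R, fun _ g h hh hsep => ?_⟩
        have hhx : h • x = x := hh
        have h1 : ¬ (g ∈ Ze T' G v₀' u v ↔ g * h ∈ Ze T' G v₀' u v) := fun hiff =>
          (half_iff hT' huv _ _).1 hiff hsep
        have h2 : g ∈ XS G x S ↔ g * h ∈ XS G x S := by
          show g • x ∈ S ↔ (g * h) • x ∈ S
          rw [mul_smul, hhx]
        have h3 : g ∈ Ze T' G v₀' u v ∆ XS G x S ∨ g * h ∈ Ze T' G v₀' u v ∆ XS G x S := by
          simp only [Set.mem_symmDiff]
          tauto
        rcases h3 with h3 | h3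
        · obtain ⟨r, hr, h4⟩ := hR _ h3
          exact ⟨r, hr, Or.inl h4⟩
        · obtain ⟨r, hr, h4⟩ := hR _ h3
          exact ⟨r, hr, Or.inr h4⟩
      · exact ⟨∅, fun h => absurd h he⟩
    choose R hR using hex
    let P : Finset (Sym2 V') := F.biUnion fun e => (R e).image fun r => eact r⁻¹ e
    refine fixed_of_bounded hT' hact' hinv' _ v₀' (P.card + P.card) ?_
    intro h hh
    obtain ⟨p, hp⟩ := hT'.connected.preconnected.exists_isPath v₀' (h • v₀')
    have hsub : p.edges.toFinset ⊆ P ∪ P.image (eact h) := by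
      intro e he
      rw [List.mem_toFinset] at he
      have hsep := path_sep hT' p hp he
      have heE := p.edges_subset_edgeSet he
      obtain ⟨e₀, he₀, g, hg⟩ := hF e heE
      have hg : eact g e₀ = e := hg
      have he₀' : eact g⁻¹ e = e₀ := by rw [← hg, eact_inv]
      have h1 := Sep.act hact' g⁻¹ hsep
      rw [he₀', ← mul_smul] at h1
      obtain ⟨r, hr, h2⟩ := hR e₀ (he₀' ▸ eact_mem_edgeSet hact' g⁻¹ heE) g⁻¹ h hh h1
      have hP : eact r⁻¹ e₀ ∈ P :=
        Finset.mem_biUnion.2 ⟨e₀, he₀, Finset.mem_image_of_mem _ hr⟩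
      rw [Finset.mem_union]
      rcases h2 with h2 | h2
      · left
        rw [mem_edgeStab, eact_mul] at h2
        rw [← hg]
        nth_rewrite 1 [← h2]
        rw [eact_inv']
        exact hP
      · right
        rw [mem_edgeStab, eact_mul, eact_mul] at h2
        rw [← hg]
        nth_rewrite 1 [← h2]
        rw [eact_inv']
        exact Finset.mem_image_of_mem _ hP
    calc T'.dist v₀' (h • v₀') ≤ p.length := SimpleGraph.dist_le p
      _ = p.edges.length := by simp
      _ = p.edges.toFinset.card := (List.toFinset_card_of_nodup hp.isTrail.edges_nodup).symm
      _ ≤ (P ∪ P.image (eact h)).card := Finset.card_le_card hsub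
      _ ≤ P.card + (P.image (eact h)).card := Finset.card_union_le _ _
      _ ≤ P.card + P.card := Nat.add_le_add_left Finset.card_image_le _
  choose c hc using hell
  let rep : V → V := fun x => (Quotient.mk (MulAction.orbitRel G V) x).out
  have hrep : ∀ x, ∃ g : G, g • rep x = x := by
    intro x
    have : (MulAction.orbitRel G V).r x (rep x) :=
      (MulAction.orbitRel G V).iseqv.symm (Quotient.mk_out (s := MulAction.orbitRel G V) x)
    exact this
  choose γ hγ using hrep
  have hrepg : ∀ (g : G) (x : V), rep (g • x) = rep x := by
    intro g x
    have : Quotient.mk (MulAction.orbitRel G V) (g • x) = Quotient.mk (MulAction.orbitRel G V) x :=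
      Quotient.sound ⟨g, rfl⟩
    show (Quotient.mk (MulAction.orbitRel G V) (g • x)).out = _
    rw [this]
  refine ⟨fun x => γ x • c (rep x), fun g x => ?_⟩
  show γ (g • x) • c (rep (g • x)) = g • γ x • c (rep x)
  have h1 : (g * γ x)⁻¹ * γ (g • x) ∈ MulAction.stabilizer G (rep x) := by
    rw [MulAction.mem_stabilizer_iff, mul_smul, inv_smul_eq_iff, mul_smul, hγ x]
    have := hγ (g • x)
    rwa [hrepg] at this
  have h2 := hc _ _ h1
  rw [mul_smul, inv_smul_eq_iff, mul_smul] at h2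
  rw [hrepg, h2]

end
end Helpers


/-- For minimal `E`-trees, `T` dominates `T'` iff `B(T') ⊆ B(T)`;
consequently `B(T) = B(T')` iff `T` and `T'` lie in the same deformation space. -/
theorem stmt_1 {G V V' : Type*} [Group G] [MulAction G V] [MulAction G V']
    (hGfg : Group.FG G)
    (T : SimpleGraph V) (T' : SimpleGraph V') (hT : T.IsTree) (hT' : T'.IsTree)
    (hact : ActsOn T G) (hact' : ActsOn T' G)
    (hinv : NoInversions T G) (hinv' : NoInversions T' G)
    (E : Set (Subgroup G)) (hE : Admissible E)
    (hET : IsETree T G E) (hET' : IsETree T' G E)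
    (hmin : MinimalAction T G) (hmin' : MinimalAction T' G)
    (v₀ : V) (v₀' : V') :
    (Dominates G T T' ↔ BT T' G v₀' ⊆ BT T G v₀) ∧
      (BT T G v₀ = BT T' G v₀' ↔ (Dominates G T T' ∧ Dominates G T' T)) := by
  have h1 : Dominates G T T' ↔ BT T' G v₀' ⊆ BT T G v₀ :=
    ⟨forward hGfg hT hT' hact hact' hinv hE hET hET' hmin hmin' v₀ v₀',
      backward hGfg hT hT' hact hact' hinv' hE hET hET' hmin' v₀ v₀'⟩
  have h2 : Dominates G T' T ↔ BT T G v₀ ⊆ BT T' G v₀' :=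
    ⟨forward hGfg hT' hT hact' hact hinv' hE hET' hET hmin' hmin v₀' v₀,
      backward hGfg hT' hT hact' hact hinv hE hET' hET hmin v₀' v₀⟩
  refine ⟨h1, ?_⟩
  rw [h1, h2]
  exact ⟨fun h => ⟨h.ge, h.le⟩, fun h => Set.Subset.antisymm h.2 h.1⟩

end SSRN
end

section
/- Let G be a finitely generated group, E an admissible family of subgroups of G, and T a minimal E-tree. If S and S' are infinite special forests based on distinct cylinders of T, and S ∩ S' is finite, then S ∩ S' = ∅. -/
open scoped Pointwise symmDiff

namespace SSRN

section Aux
variable {G V : Type*} [Group G] [MulAction G V]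

theorem mem_edgeStab_iff (T : SimpleGraph V) (hinv : NoInversions T G) {u v : V}
    (h : T.Adj u v) (g : G) : g ∈ edgeStab G s(u, v) ↔ g • u = u ∧ g • v = v := by
  change Sym2.map (g • ·) s(u, v) = s(u, v) ↔ _
  rw [Sym2.map_mk, Sym2.eq_iff]
  constructor
  · rintro (h1 | h1)
    · exact h1
    · exact absurd h1 (hinv g u v h)
  · exact Or.inl

theorem fix_of_mem (T : SimpleGraph V) (hinv : NoInversions T G) {e : Sym2 V}
    (he : e ∈ T.edgeSet) {g : G} (hg : g ∈ edgeStab G e) {u : V} (hu : u ∈ e) : g • u = u := by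
  obtain ⟨v, rfl⟩ := hu
  exact ((mem_edgeStab_iff T hinv (by simpa using he) g).1 hg).1

theorem fix_support (T : SimpleGraph V) (hT : T.IsTree) (hact : ActsOn T G)
    {u v : V} (p : T.Walk u v) (hp : p.IsPath) {g : G} (hu : g • u = u) (hv : g • v = v) :
    ∀ x ∈ p.support, g • x = x := by
  let f : T →g T := ⟨fun x => g • x, fun {a b} h => hact g a b h⟩
  have hf : Function.Injective f := MulAction.injective g
  have h1 : ((p.map f).copy hu hv).IsPath := by
    rw [SimpleGraph.Walk.isPath_copy]
    exact SimpleGraph.Walk.map_isPath_of_injective hf hp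
  have h2 : (p.map f).copy hu hv = p := by
    have := hT.isAcyclic.path_unique ⟨_, h1⟩ ⟨p, hp⟩
    exact congrArg Subtype.val this
  have h3 : p.support.map f = p.support := by
    conv_rhs => rw [← h2]
    simp
  have h4 : p.support.map f = p.support.map id := by simpa using h3
  exact fun x hx => List.map_inj_left.1 h4 x hx

/-- the stabilizer of an edge at a vertex of finite valence is commensurable to the
vertex stabilizer. -/
theorem comm_vertex (T : SimpleGraph V) (hact : ActsOn T G) (hinv : NoInversions T G) {v w : V}
    (h : T.Adj v w) (hf : (T.neighborSet v).Finite) :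
    Subgroup.Commensurable (edgeStab G s(v, w)) (MulAction.stabilizer G v) := by
  have hle : edgeStab G s(v, w) ≤ MulAction.stabilizer G v := by
    intro g hg
    exact ((mem_edgeStab_iff T hinv h g).1 hg).1
  refine ⟨?_, ?_⟩
  · have hst : (edgeStab G s(v, w)).subgroupOf (MulAction.stabilizer G v) =
        MulAction.stabilizer (MulAction.stabilizer G v) w := by
      ext ⟨g, hg⟩
      rw [Subgroup.mem_subgroupOf, mem_edgeStab_iff T hinv h, MulAction.mem_stabilizer_iff]
      rw [MulAction.mem_stabilizer_iff] at hg
      exact ⟨fun h => h.2, fun h => ⟨hg, h⟩⟩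
    have hfin : (MulAction.orbit (MulAction.stabilizer G v) w).Finite := by
      refine hf.subset ?_
      rintro _ ⟨⟨g, hg⟩, rfl⟩
      have := hact g v w h
      rw [MulAction.mem_stabilizer_iff] at hg
      rw [hg] at this
      exact this
    rw [Subgroup.relIndex, hst, MulAction.index_stabilizer]
    exact ((Set.ncard_pos hfin).2 ⟨w, MulAction.mem_orbit_self w⟩).ne'
  · rw [Subgroup.relIndex_eq_one.2 hle]
    exact one_ne_zero

theorem walk_aux (T : SimpleGraph V) (S S' : Set V) (Y : Set (Sym2 V))
    (hS : cobdry T S ⊆ Y) (hYS : cylVerts Y ⊆ S') {a b : V} (p : T.Walk a b) :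
    a ∈ S → a ∉ cylVerts Y → b ∈ cylVerts Y →
      ∃ x ∈ S ∩ S', x ∈ cylVerts Y ∧ ∃ y, T.Adj x y ∧ s(x, y) ∉ Y := by
  induction p with
  | nil => intro _ h1 h2; exact absurd h2 h1
  | @cons a c b h p ih =>
    intro ha haY hb
    have hn : s(a, c) ∉ Y := fun hh => haY ⟨_, hh, by simp⟩
    have hc : c ∈ S := by
      by_contra hc
      exact hn (hS ⟨h, a, c, rfl, ha, hc⟩)
    by_cases hcY : c ∈ cylVerts Y
    · exact ⟨c, ⟨hc, hYS hcY⟩, hcY, a, h.symm, by rwa [Sym2.eq_swap]⟩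
    · exact ih hc hcY hb

theorem core (T : SimpleGraph V) (hT : T.IsTree) (hact : ActsOn T G) (hinv : NoInversions T G)
    (E : Set (Subgroup G)) (hE : Admissible E) (hET : IsETree T G E)
    (Y Y' : Set (Sym2 V)) (hY : IsCylinder T G Y) (hY' : IsCylinder T G Y') (hne : Y ≠ Y')
    (S S' : Set V) (hS : IsSpecialForest T S Y) (hS' : IsSpecialForest T S' Y')
    (hSi : S.Infinite) (hfin : (S ∩ S').Finite)
    (u v : V) (huv : T.Adj u v) (huS : u ∈ S) (huS' : u ∈ S') (hv : v ∉ S) : False := by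
  have hdisj : ∀ f ∈ Y, f ∉ Y' := by
    intro f hf hf'
    apply hne
    ext e
    constructor
    · intro he
      have he' := hY.2.1 he
      exact (hY'.2.2 f hf' e he').2 ((hY.2.2 f hf e he').1 he)
    · intro he
      have he' := hY'.2.1 he
      exact (hY.2.2 f hf e he').2 ((hY'.2.2 f hf' e he').1 he)
  have hval : ∀ x ∈ S ∩ S', (T.neighborSet x).Finite := by
    intro x hx
    have h2 : ((fun y => s(x, y)) ⁻¹' (cobdry T S ∪ cobdry T S')).Finite := by
      refine (hS.1.union hS'.1).preimage ?_
      intro a _ b _ hab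
      exact Sym2.congr_right.1 hab
    refine (hfin.union h2).subset ?_
    intro y hy
    by_cases h3 : y ∈ S
    · by_cases h4 : y ∈ S'
      · exact Or.inl ⟨h3, h4⟩
      · exact Or.inr (Or.inr ⟨hy, x, y, rfl, hx.2, h4⟩)
    · exact Or.inr (Or.inl ⟨hy, x, y, rfl, hx.1, h3⟩)
  have heY : s(u, v) ∈ Y := hS.2 ⟨huv, u, v, rfl, huS, hv⟩
  have hYS : cylVerts Y ⊆ S' := by
    rintro y ⟨e', he', hy⟩
    by_contra hyS
    obtain ⟨p, hp, -⟩ := hT.existsUnique_path u y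
    obtain ⟨d, hd, hd1, hd2⟩ := p.exists_boundary_dart S' huS' hyS
    have hfY' : s(d.fst, d.snd) ∈ Y' := hS'.2 ⟨d.adj, _, _, rfl, hd1, hd2⟩
    refine hdisj _ ?_ hfY'
    rw [hY.2.2 _ heY _ d.adj]
    have hc := (hY.2.2 _ heY _ (hY.2.1 he')).1 he'
    set A := edgeStab G s(u, v)
    set B := edgeStab G e'
    set F := edgeStab G s(d.fst, d.snd)
    have hle : A ⊓ B ≤ F := by
      intro g hg
      have h1 := fix_of_mem T hinv huv hg.1 (Sym2.mem_mk_left u v)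
      have h2 := fix_of_mem T hinv (hY.2.1 he') hg.2 hy
      have h3 := fix_support T hT hact p hp h1 h2
      exact (mem_edgeStab_iff T hinv d.adj g).2
        ⟨h3 _ (p.dart_fst_mem_support_of_mem_darts hd),
          h3 _ (p.dart_snd_mem_support_of_mem_darts hd)⟩
    have hcA : Subgroup.Commensurable (A ⊓ B) A := by
      refine ⟨?_, ?_⟩
      · rw [Subgroup.inf_relIndex_left]; exact hc.2
      · rw [Subgroup.relIndex_eq_one.2 inf_le_left]; exact one_ne_zero
    have hcF : Subgroup.Commensurable (A ⊓ B) F := by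
      refine ⟨hE.2.2 _ (hE.2.1 _ (hET _ huv) _ hcA) _ (hET _ d.adj) hle, ?_⟩
      rw [Subgroup.relIndex_eq_one.2 hle]; exact one_ne_zero
    exact hcA.symm.trans hcF
  obtain ⟨s, hs, hsn⟩ : ∃ s ∈ S, s ∉ S' := by
    by_contra! hcon
    exact hSi (hfin.subset fun x hx => ⟨hx, hcon x hx⟩)
  obtain ⟨p, -, -⟩ := hT.existsUnique_path s u
  obtain ⟨x, hx, ⟨e, he, hxe⟩, y, hxy, hyn⟩ := walk_aux T S S' Y hS.2 hYS p hs
    (fun h => hsn (hYS h)) ⟨_, heY, by simp⟩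
  obtain ⟨z, rfl⟩ := hxe
  apply hyn
  rw [hY.2.2 _ he _ hxy]
  have hxz : T.Adj x z := hY.2.1 he
  exact (comm_vertex T hact hinv hxz (hval x hx)).trans
    (comm_vertex T hact hinv hxy (hval x hx)).symm

end Aux


/-- Infinite special forests based on distinct cylinders with finite
intersection are disjoint. -/
theorem stmt_4 {G V : Type*} [Group G] [MulAction G V]
    (hGfg : Group.FG G)
    (T : SimpleGraph V) (hT : T.IsTree) (hact : ActsOn T G) (hinv : NoInversions T G)
    (E : Set (Subgroup G)) (hE : Admissible E) (hET : IsETree T G E)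
    (hmin : MinimalAction T G)
    (Y Y' : Set (Sym2 V)) (hY : IsCylinder T G Y) (hY' : IsCylinder T G Y') (hne : Y ≠ Y')
    (S S' : Set V) (hS : IsSpecialForest T S Y) (hS' : IsSpecialForest T S' Y')
    (hSi : S.Infinite) (hS'i : S'.Infinite)
    (hfin : (S ∩ S').Finite) :
    S ∩ S' = ∅ := by
  by_contra hcon
  obtain ⟨x, hx⟩ := Set.nonempty_iff_ne_empty.2 hcon
  obtain ⟨y, hy⟩ : ∃ y, y ∉ S ∩ S' := by
    by_contra! hall
    exact hSi (hfin.subset fun z _ => hall z)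
  obtain ⟨p, -, -⟩ := hT.existsUnique_path x y
  obtain ⟨d, -, hd1, hd2⟩ := p.exists_boundary_dart (S ∩ S') hx hy
  by_cases h : d.snd ∈ S
  · have h' : d.snd ∉ S' := fun h' => hd2 ⟨h, h'⟩
    exact core T hT hact hinv E hE hET Y' Y hY' hY hne.symm S' S hS' hS hS'i
      (by rwa [Set.inter_comm]) d.fst d.snd d.adj hd1.2 hd1.1 h'
  · exact core T hT hact hinv E hE hET Y Y' hY hY' hne S S' hS hS' hSi hfin
      d.fst d.snd d.adj hd1.1 hd1.2 h

end SSRN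
end

section
/- Let G be a finitely generated group, E an admissible family of subgroups of G, and T a minimal E-tree with basepoint vertex v₀. If S and S' are special forests of T such that X_S crosses X_{S'}, then S and S' are based on the same cylinder. -/
open scoped Pointwise symmDiff

namespace SSRN


lemma side_const {V : Type*} {T : SimpleGraph V} {A : Set V} {Y : Set (Sym2 V)}
    (hA : ∀ u v, T.Adj u v → s(u, v) ∉ Y → (u ∈ A ↔ v ∈ A)) {u v : V} (p : T.Walk u v)
    (hp : ∀ e ∈ p.edges, e ∉ Y) : u ∈ A ↔ v ∈ A := by
  induction p with
  | nil => rfl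
  | cons h p ih =>
    simp only [SimpleGraph.Walk.edges_cons, List.mem_cons, forall_eq_or_imp] at hp
    exact (hA _ _ h hp.1).trans (ih hp.2)

lemma corner_empty {V : Type*} {T : SimpleGraph V} {A B : Set V} {Y Y' : Set (Sym2 V)}
    (hA : ∀ u v, T.Adj u v → s(u, v) ∉ Y → (u ∈ A ↔ v ∈ A))
    (hB : ∀ u v, T.Adj u v → s(u, v) ∉ Y' → (u ∈ B ↔ v ∈ B))
    (hYB : ∀ v ∈ cylVerts Y, v ∉ B) (hYA : ∀ v ∈ cylVerts Y', v ∉ A)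
    {w y : V} (p : T.Walk w y) (hy : y ∈ cylVerts Y) : ¬ (w ∈ A ∧ w ∈ B) := by
  induction p with
  | nil => exact fun h => hYB _ hy h.2
  | cons h p ih =>
    rintro ⟨h1, h2⟩
    refine ih hy ⟨(hA _ _ h fun hc => ?_).1 h1, (hB _ _ h fun hc => ?_).1 h2⟩
    · exact hYB _ ⟨_, hc, Sym2.mem_mk_left _ _⟩ h2
    · exact hYA _ ⟨_, hc, Sym2.mem_mk_left _ _⟩ h1

lemma adj_of_cobdry {V : Type*} {T : SimpleGraph V} {S : Set V} {Y : Set (Sym2 V)}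
    (hS : cobdry T S ⊆ Y) (u v : V) (h : T.Adj u v) (hY : s(u, v) ∉ Y) : u ∈ S ↔ v ∈ S := by
  constructor
  · intro hu
    by_contra hv
    exact hY (hS ⟨h, u, v, rfl, hu, hv⟩)
  · intro hv
    by_contra hu
    exact hY (hS ⟨h, v, u, Sym2.eq_swap, hv, hu⟩)

lemma fix_of_edgeStab_s5 {G V : Type*} [Group G] [MulAction G V] {T : SimpleGraph V}
    (hinv : NoInversions T G) {e : Sym2 V} (he : e ∈ T.edgeSet) {g : G}
    (hg : g ∈ edgeStab G e) {v : V} (hv : v ∈ e) : g • v = v := by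
  induction e using Sym2.ind with
  | _ a b =>
    have hg' : s(g • a, g • b) = s(a, b) := hg
    rw [Sym2.eq_iff] at hg'
    rcases hg' with h | h
    · rcases Sym2.mem_iff.1 hv with rfl | rfl
      · exact h.1
      · exact h.2
    · exact (hinv g a b he h).elim

lemma fix_path {G V : Type*} [Group G] [MulAction G V] {T : SimpleGraph V} (hT : T.IsTree)
    (hact : ActsOn T G) (g : G) {u v : V} (hu : g • u = u) (hv : g • v = v)
    (p : T.Walk u v) (hp : p.IsPath) (e : Sym2 V) (he : e ∈ p.edges) : g ∈ edgeStab G e := by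
  let f : T →g T := ⟨fun x => g • x, fun {a b} h => hact g a b h⟩
  have hq : (p.map f).IsPath := SimpleGraph.Walk.map_isPath_of_injective
    (MulAction.injective g) hp
  have hsup : (p.map f).support = p.support := by
    have : ((p.map f).copy hu hv) = p :=
      congrArg Subtype.val (hT.isAcyclic.path_unique
        ⟨(p.map f).copy hu hv, by simpa using hq⟩ ⟨p, hp⟩)
    conv_rhs => rw [← this]
    simp
  rw [SimpleGraph.Walk.support_map] at hsup
  have key : ∀ x ∈ p.support, g • x = x := by
    have : p.support.map f = p.support.map id := by simpa using hsup
    exact List.map_inj_left.1 this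
  induction e using Sym2.ind with
  | _ a b =>
    show s(g • a, g • b) = s(a, b)
    rw [key a (p.fst_mem_support_of_mem_edges he), key b (p.snd_mem_support_of_mem_edges he)]

lemma cyl_convex {G V : Type*} [Group G] [MulAction G V] {T : SimpleGraph V} (hT : T.IsTree)
    (hact : ActsOn T G) (hinv : NoInversions T G)
    {E : Set (Subgroup G)} (hE : Admissible E) (hET : IsETree T G E)
    {Y : Set (Sym2 V)} (hY : IsCylinder T G Y) {u v : V} (hu : u ∈ cylVerts Y)
    (hv : v ∈ cylVerts Y) : ∃ p : T.Walk u v, ∀ e ∈ p.edges, e ∈ Y := by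
  obtain ⟨p, hp⟩ := (hT.connected u v).exists_isPath
  refine ⟨p, fun e he => ?_⟩
  obtain ⟨a, ha, hua⟩ := hu
  obtain ⟨b, hb, hvb⟩ := hv
  have haT := hY.2.1 ha
  have hbT := hY.2.1 hb
  have heT := p.edges_subset_edgeSet he
  have hc := (hY.2.2 a ha b hbT).1 hb
  have hle : edgeStab G a ⊓ edgeStab G b ≤ edgeStab G e := fun g hg =>
    fix_path hT hact g (fix_of_edgeStab_s5 hinv haT hg.1 hua) (fix_of_edgeStab_s5 hinv hbT hg.2 hvb)
      p hp e he
  have hK : Subgroup.Commensurable (edgeStab G a ⊓ edgeStab G b) (edgeStab G a) := by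
    refine And.symm ⟨?_, ?_⟩
    · rw [Subgroup.relIndex_eq_one.2 inf_le_left]; simp
    · rw [Subgroup.inf_relIndex_left]; exact hc.2
  have hK' : Subgroup.Commensurable (edgeStab G a ⊓ edgeStab G b) (edgeStab G e) := by
    refine And.symm ⟨?_, ?_⟩
    · rw [Subgroup.relIndex_eq_one.2 hle]; simp
    · exact hE.2.2 _ (hE.2.1 _ (hET a haT) _ hK) _ (hET e heT) hle
  exact (hY.2.2 a ha e heT).2 (hK.symm.trans hK')

theorem stmt_5 {G V : Type*} [Group G] [MulAction G V]
    (hGfg : Group.FG G)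
    (T : SimpleGraph V) (hT : T.IsTree) (hact : ActsOn T G) (hinv : NoInversions T G)
    (E : Set (Subgroup G)) (hE : Admissible E) (hET : IsETree T G E)
    (hmin : MinimalAction T G) (v₀ : V)
    (Y Y' : Set (Sym2 V)) (hY : IsCylinder T G Y) (hY' : IsCylinder T G Y')
    (S S' : Set V) (hS : IsSpecialForest T S Y) (hS' : IsSpecialForest T S' Y')
    (hcross : Crosses (⨅ e ∈ cobdry T S, edgeStab G e) (XS G v₀ S) (XS G v₀ S')) :
    Y = Y' := by
  by_contra hne
  have hdisj : ∀ e ∈ Y, e ∉ Y' := by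
    intro e h h'
    apply hne
    ext f
    constructor
    · intro hf
      exact (hY'.2.2 e h' f (hY.2.1 hf)).2 ((hY.2.2 e h f (hY.2.1 hf)).1 hf)
    · intro hf
      exact (hY.2.2 e h f (hY'.2.1 hf)).2 ((hY'.2.2 e h' f (hY'.2.1 hf)).1 hf)
  have hA := adj_of_cobdry hS.2
  have hB := adj_of_cobdry hS'.2
  have hA' : ∀ u v, T.Adj u v → s(u, v) ∉ Y → (u ∈ Sᶜ ↔ v ∈ Sᶜ) :=
    fun u v h h' => not_congr (hA u v h h')
  have hB' : ∀ u v, T.Adj u v → s(u, v) ∉ Y' → (u ∈ S'ᶜ ↔ v ∈ S'ᶜ) :=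
    fun u v h h' => not_congr (hB u v h h')
  have vert : ∀ Z : Set (Sym2 V), IsCylinder T G Z → ∃ v, v ∈ cylVerts Z := by
    rintro Z ⟨⟨e, he⟩, -⟩
    induction e using Sym2.ind with
    | _ a b => exact ⟨a, _, he, Sym2.mem_mk_left _ _⟩
  obtain ⟨y, hy⟩ := vert Y hY
  obtain ⟨y', hy'⟩ := vert Y' hY'
  have c1 : ∀ v ∈ cylVerts Y, (y ∈ S' ↔ v ∈ S') := by
    intro v hv
    obtain ⟨p, hp⟩ := cyl_convex hT hact hinv hE hET hY hy hv
    exact side_const hB p fun e he => hdisj e (hp e he)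
  have c2 : ∀ v ∈ cylVerts Y', (y' ∈ S ↔ v ∈ S) := by
    intro v hv
    obtain ⟨p, hp⟩ := cyl_convex hT hact hinv hE hET hY' hy' hv
    exact side_const hA p fun e he h => hdisj e h (hp e he)
  have fin : ∀ (H : Subgroup G) (A B : Set V), (∀ w, ¬ (w ∈ A ∧ w ∈ B)) →
      HFin H (XS G v₀ A ∩ XS G v₀ B) :=
    fun H A B h => ⟨∅, fun g hg => (h _ hg).elim⟩
  obtain ⟨x1, x2, x3, x4⟩ := hcross
  have walk : ∀ w, ∃ _ : T.Walk w y, True := fun w => ⟨(hT.connected w y).some, trivial⟩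
  by_cases h1 : y ∈ S' <;> by_cases h2 : y' ∈ S
  · refine x4 (fin _ Sᶜ S'ᶜ fun w => ?_)
    exact corner_empty hA' hB' (fun v hv h => h ((c1 v hv).1 h1))
      (fun v hv h => h ((c2 v hv).1 h2)) (walk w).choose hy
  · refine x2 (fin _ S S'ᶜ fun w => ?_)
    exact corner_empty hA hB' (fun v hv h => h ((c1 v hv).1 h1))
      (fun v hv h => h2 ((c2 v hv).2 h)) (walk w).choose hy
  · refine x3 (fin _ Sᶜ S' fun w => ?_)
    exact corner_empty hA' hB (fun v hv h => h1 ((c1 v hv).2 h))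
      (fun v hv h => h ((c2 v hv).1 h2)) (walk w).choose hy
  · refine x1 (fin _ S S' fun w => ?_)
    exact corner_empty hA hB (fun v hv h => h1 ((c1 v hv).2 h))
      (fun v hv h => h2 ((c2 v hv).2 h)) (walk w).choose hy

end SSRN
end
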